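/- arXiv:1509.09189 — 6 statements merged into one kernel-verified Lean document; each statement's English description precedes it below -/
import Mathlib

section
/- Let X be a finite-dimensional real normed space, let x_1, …, x_n be vectors in X, and let λ_1, …, λ_n be real numbers with 0 ≤ λ_i ≤ 1 for each i. Then there exist numbers θ_1, …, θ_n ∈ {0, 1} such that ‖Σ_{i=1}^n (λ_i − θ_i)·x_i‖ ≤ (dim X / 2) · max_i ‖x_i‖. -/
open Filter Topology in
/-- One can replace the coefficients by ones with at most `dim X` fractional entries. -/
theorem exists_few_fractional {X : Type*} [NormedAddCommGroup X] [NormedSpace ℝ X]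
    [FiniteDimensional ℝ X] (n : ℕ) (x : Fin n → X) (l : Fin n → ℝ)
    (hl : ∀ i, 0 ≤ l i ∧ l i ≤ 1) :
    ∃ m : Fin n → ℝ, (∀ i, 0 ≤ m i ∧ m i ≤ 1) ∧ ∑ i, m i • x i = ∑ i, l i • x i ∧
      (Finset.univ.filter (fun i => m i ≠ 0 ∧ m i ≠ 1)).card ≤ Module.finrank ℝ X := by
  classical
  let K : Set (Fin n → ℝ) := Set.Icc 0 1 ∩ {m | ∑ i, m i • x i = ∑ i, l i • x i}
  have hK : IsCompact K := isCompact_Icc.inter_right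
    (isClosed_eq (by fun_prop) continuous_const)
  have hne : K.Nonempty := ⟨l, ⟨fun i => (hl i).1, fun i => (hl i).2⟩, rfl⟩
  obtain ⟨m, hm⟩ := hK.extremePoints_nonempty hne
  obtain ⟨⟨⟨h0, h1⟩, hs⟩, hext⟩ := hm
  refine ⟨m, fun i => ⟨h0 i, h1 i⟩, hs, ?_⟩
  by_contra hcard
  have hnl : ¬ LinearIndependent ℝ
      (fun i : {i // i ∈ Finset.univ.filter (fun i => m i ≠ 0 ∧ m i ≠ 1)} => x i) := by
    intro h
    have := h.fintype_card_le_finrank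
    rw [Fintype.card_coe] at this
    exact hcard this
  obtain ⟨g, hg, j, hj⟩ := Fintype.not_linearIndependent_iff.1 hnl
  let c : Fin n → ℝ := fun i =>
    if h : i ∈ Finset.univ.filter (fun i => m i ≠ 0 ∧ m i ≠ 1) then g ⟨i, h⟩ else 0
  have hcj : c j ≠ 0 := by
    simp only [c, dif_pos j.2]; exact hj
  have hc0 : ∀ i, i ∉ Finset.univ.filter (fun i => m i ≠ 0 ∧ m i ≠ 1) → c i = 0 := by
    intro i hi
    simp only [c, dif_neg hi]
  have hc : ∑ i, c i • x i = 0 := by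
    rw [← hg, ← Finset.sum_subset (Finset.subset_univ
      (Finset.univ.filter (fun i => m i ≠ 0 ∧ m i ≠ 1)))
      (fun i _ hi => by rw [hc0 i hi, zero_smul]), ← Finset.sum_coe_sort]
    refine Finset.sum_congr rfl fun i _ => ?_
    simp only [c, dif_pos i.2]
  have hev : ∀ a : ℝ, ∀ᶠ t in 𝓝 (0:ℝ), ∀ i, 0 ≤ m i + t * (a * c i) ∧ m i + t * (a * c i) ≤ 1 := by
    intro a
    rw [eventually_all]
    intro i
    by_cases hi : i ∈ Finset.univ.filter (fun i => m i ≠ 0 ∧ m i ≠ 1)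
    · have hi' := (Finset.mem_filter.1 hi).2
      have ht : Tendsto (fun t : ℝ => m i + t * (a * c i)) (𝓝 0) (𝓝 (m i)) := by
        have : Continuous (fun t : ℝ => m i + t * (a * c i)) := by fun_prop
        simpa using this.tendsto 0
      filter_upwards [ht.eventually_const_le (lt_of_le_of_ne (h0 i) hi'.1.symm),
        ht.eventually_le_const (lt_of_le_of_ne (h1 i) hi'.2)] with t a b
      exact ⟨a, b⟩
    · rw [hc0 i hi]
      exact Eventually.of_forall fun t => by simpa using ⟨h0 i, h1 i⟩
  obtain ⟨t, ⟨hp, hq⟩, ht⟩ := (((hev 1).and (hev (-1))).filter_mono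
    (nhdsWithin_le_nhds (s := Set.Ioi 0)) |>.and self_mem_nhdsWithin).exists
  have ht : 0 < t := ht
  have hmem : ∀ a : ℝ, (∀ i, 0 ≤ m i + t * (a * c i) ∧ m i + t * (a * c i) ≤ 1) →
      (fun i => m i + t * (a * c i)) ∈ K := by
    intro a ha
    refine ⟨⟨fun i => (ha i).1, fun i => (ha i).2⟩, ?_⟩
    change ∑ i, (m i + t * (a * c i)) • x i = _
    have hs' : ∑ i, m i • x i = ∑ i, l i • x i := hs
    simp only [add_smul, Finset.sum_add_distrib, mul_smul, ← Finset.smul_sum, hc, hs']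
    simp
  have := hext (hmem 1 hp) (hmem (-1) hq)
    ⟨1/2, 1/2, by norm_num, by norm_num, by norm_num, by
      ext i; simp only [Pi.add_apply, Pi.smul_apply, smul_eq_mul]; ring⟩
  have h2 := congrFun this j
  have h3 : t * c j = 0 := by linarith
  exact (mul_ne_zero ht.ne' hcj) h3

/-- **Lemma on rounding off coefficients.** Given vectors `x₁, …, xₙ` in a
finite-dimensional real normed space `X` and reals `0 ≤ λᵢ ≤ 1`, there exist
`θᵢ ∈ {0, 1}` with `‖∑ (λᵢ - θᵢ) • xᵢ‖ ≤ (dim X / 2) ⬝ maxᵢ ‖xᵢ‖`. -/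
theorem rounding_off_coefficients {X : Type*} [NormedAddCommGroup X] [NormedSpace ℝ X]
    [FiniteDimensional ℝ X] (n : ℕ) (x : Fin n → X) (l : Fin n → ℝ)
    (hl : ∀ i, 0 ≤ l i ∧ l i ≤ 1) :
    ∃ θ : Fin n → ℝ, (∀ i, θ i = 0 ∨ θ i = 1) ∧
      ‖∑ i, (l i - θ i) • x i‖ ≤ (Module.finrank ℝ X : ℝ) / 2 * ⨆ i, ‖x i‖ := by
  obtain ⟨m, hm, hs, hcard⟩ := exists_few_fractional n x l hl
  have hM : ∀ i, ‖x i‖ ≤ ⨆ i, ‖x i‖ := fun i => le_ciSup (f := fun i => ‖x i‖) (Set.finite_range _).bddAbove i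
  have hM0 : 0 ≤ ⨆ i, ‖x i‖ := Real.iSup_nonneg fun i => norm_nonneg _
  set M := ⨆ i, ‖x i‖
  refine ⟨fun i => if m i ≤ 1/2 then 0 else 1, fun i => by
    by_cases h : m i ≤ 1/2 <;> simp only [h, if_true, if_false, true_or, or_true], ?_⟩
  have e : ∑ i, (l i - if m i ≤ 1/2 then (0:ℝ) else 1) • x i
      = ∑ i, (m i - if m i ≤ 1/2 then (0:ℝ) else 1) • x i := by
    simp only [sub_smul, Finset.sum_sub_distrib, hs]
  rw [e]
  calc _ ≤ ∑ i, ‖(m i - if m i ≤ 1/2 then (0:ℝ) else 1) • x i‖ := norm_sum_le _ _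
    _ ≤ ∑ i, if m i ≠ 0 ∧ m i ≠ 1 then 1/2 * M else 0 := by
        refine Finset.sum_le_sum fun i _ => ?_
        rw [norm_smul, Real.norm_eq_abs]
        split_ifs with h1 h2 h2
        · refine mul_le_mul ?_ (hM i) (norm_nonneg _) (by norm_num)
          rw [abs_le]; constructor <;> linarith [(hm i).1]
        · have : m i = 0 := by
            by_contra h
            exact h2 ⟨h, by intro h'; norm_num [h'] at h1⟩
          simp [this]
        · refine mul_le_mul ?_ (hM i) (norm_nonneg _) (by norm_num)
          rw [abs_le]; constructor <;> linarith [(hm i).2]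
        · have : m i = 1 := by
            by_contra h
            exact h2 ⟨by intro h'; norm_num [h'] at h1, h⟩
          simp [this]
    _ = ((Finset.univ.filter (fun i => m i ≠ 0 ∧ m i ≠ 1)).card : ℝ) * (1/2 * M) := by
        rw [← Finset.sum_filter, Finset.sum_const, nsmul_eq_mul]
    _ ≤ (Module.finrank ℝ X : ℝ) * (1/2 * M) := by
        gcongr
    _ = _ := by ring
end

section
/- Let E be an atomless Dedekind complete vector lattice, X a Banach space, and T : E → X an orthogonally additive, laterally-to-norm continuous operator. If e ∈ E₊ and (v_n)_{n≥1} is a sequence in E with |v_n| ≤ e for all n and v_n ⊥ v_m for all n ≠ m, then lim_{n→∞} ‖T(v_n)‖ = 0. -/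
/-- Disjointness in a lattice-ordered group: `|x| ⊓ |y| = 0`. -/
def OrthDisjoint {E : Type*} [Lattice E] [AddCommGroup E] (x y : E) : Prop :=
  |x| ⊓ |y| = 0

/-- `y` is a fragment of `x`: `y ⊥ (x - y)`. -/
def Fragment {E : Type*} [Lattice E] [AddCommGroup E] (y x : E) : Prop :=
  OrthDisjoint y (x - y)

/-- Orthogonally additive map. -/
def IsOrthAdditive {E : Type*} [Lattice E] [AddCommGroup E] {X : Type*} [AddCommGroup X]
    (T : E → X) : Prop :=
  ∀ x y : E, OrthDisjoint x y → T (x + y) = T x + T y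

/-- `e` is an atom of the vector lattice. -/
def IsVLAtom {E : Type*} [Lattice E] [AddCommGroup E] (e : E) : Prop :=
  0 < e ∧ ∀ f₁ f₂ : E, 0 ≤ f₁ → f₁ ≤ e → 0 ≤ f₂ → f₂ ≤ e →
    OrthDisjoint f₁ f₂ → f₁ = 0 ∨ f₂ = 0

/-- Atomless vector lattice. -/
def Atomless (E : Type*) [Lattice E] [AddCommGroup E] : Prop :=
  ∀ e : E, ¬ IsVLAtom e

/-- Narrow operator into a normed space. -/
def IsNarrow {E : Type*} [Lattice E] [AddCommGroup E] {X : Type*} [SeminormedAddCommGroup X]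
    (T : E → X) : Prop :=
  ∀ x : E, ∀ ε : ℝ, 0 < ε → ∃ x₁ x₂ : E, Fragment x₁ x ∧ Fragment x₂ x ∧ x = x₁ + x₂ ∧
    ‖T x₁ - T x₂‖ < ε

/-- A net order converges to zero. -/
def NetOrderConvZero {F : Type*} [Lattice F] [AddCommGroup F] {A : Type*} [Preorder A]
    (y : A → F) : Prop :=
  ∃ (B : Type) (_ : Preorder B) (f : B → F),
    IsDirected B (· ≤ ·) ∧ Nonempty B ∧
    (∀ b₁ b₂ : B, b₁ ≤ b₂ → f b₂ ≤ f b₁) ∧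
    IsGLB (Set.range f) 0 ∧
    ∀ b : B, ∃ a₀ : A, ∀ a : A, a₀ ≤ a → |y a| ≤ f b

/-- Order narrow operator between vector lattices. -/
def IsOrderNarrow {E : Type*} [Lattice E] [AddCommGroup E] {F : Type*} [Lattice F]
    [AddCommGroup F] (T : E → F) : Prop :=
  ∀ x : E, ∃ (A : Type) (_ : Preorder A), IsDirected A (· ≤ ·) ∧ Nonempty A ∧
    ∃ x₁ x₂ : A → E,
      (∀ a : A, Fragment (x₁ a) x ∧ Fragment (x₂ a) x ∧ x = x₁ a + x₂ a) ∧
      NetOrderConvZero (fun a => T (x₁ a) - T (x₂ a))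

/-- Lateral convergence of a net to `v`. -/
def LaterallyConvTo {E : Type*} [Lattice E] [AddCommGroup E] {A : Type*} [Preorder A]
    (x : A → E) (v : E) : Prop :=
  (∀ a b : A, a ≤ b → Fragment (x a) (x b)) ∧ (∀ a : A, Fragment (x a) v) ∧
    NetOrderConvZero (fun a => x a - v)

/-- Laterally-to-norm continuous operator. -/
def LatToNormCont {E : Type*} [Lattice E] [AddCommGroup E] {X : Type*}
    [SeminormedAddCommGroup X] (T : E → X) : Prop :=
  ∀ (A : Type) (_ : Preorder A), IsDirected A (· ≤ ·) → Nonempty A →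
    ∀ (x : A → E) (v : E), LaterallyConvTo x v →
      Filter.Tendsto (fun a => T (x a)) Filter.atTop (nhds (T v))

/-- Order bounded operator. -/
def IsOrderBounded {E : Type*} [Preorder E] {F : Type*} [Preorder F] (T : E → F) : Prop :=
  ∀ s : Set E, BddBelow s → BddAbove s → BddBelow (T '' s) ∧ BddAbove (T '' s)

/-- C-compact operator. -/
def IsCCompact {E : Type*} [Lattice E] [AddCommGroup E] {X : Type*} [SeminormedAddCommGroup X]
    (T : E → X) : Prop :=
  ∀ x : E, TotallyBounded (T '' {y : E | Fragment y x})




section helpers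
variable {E : Type*} [AddCommGroup E] [Lattice E] [CovariantClass E E (· + ·) (· ≤ ·)]

lemma aux_inf_add {a b c : E} (ha : 0 ≤ a) (hb : 0 ≤ b) (hc : 0 ≤ c) (h1 : a ⊓ b = 0)
    (h2 : a ⊓ c = 0) : a ⊓ (b + c) = 0 := by
  apply le_antisymm
  · have hz : a ⊓ (b + c) - b ≤ a ⊓ c := by
      apply le_inf
      · exact (sub_le_self _ hb).trans inf_le_left
      · rw [sub_le_iff_le_add']; exact inf_le_right
    rw [h2, sub_nonpos] at hz
    rw [← h1]
    exact le_inf inf_le_left hz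
  · exact le_inf ha (add_nonneg hb hc)

lemma aux_inf_mono {a b a' b' : E} (ha : 0 ≤ a) (hb : 0 ≤ b) (h1 : a ≤ a') (h2 : b ≤ b')
    (h : a' ⊓ b' = 0) : a ⊓ b = 0 :=
  le_antisymm (h ▸ inf_le_inf h1 h2) (le_inf ha hb)

lemma aux_inf_sum {a : E} (ha : 0 ≤ a) (x : ℕ → E) (s : Finset ℕ) (hx : ∀ k, 0 ≤ x k)
    (h : ∀ k ∈ s, a ⊓ x k = 0) : a ⊓ (∑ k ∈ s, x k) = 0 := by
  classical
  induction s using Finset.induction_on with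
  | empty => simpa using ha
  | insert i s hi ih =>
    rw [Finset.sum_insert hi]
    exact aux_inf_add ha (hx i) (Finset.sum_nonneg fun k _ => hx k)
      (h i (Finset.mem_insert_self _ _)) (ih fun k hk => h k (Finset.mem_insert_of_mem hk))

lemma aux_sum_le {x : ℕ → E} {e : E} (he : 0 ≤ e) (hx : ∀ k, 0 ≤ x k) (hxe : ∀ k, x k ≤ e)
    (hd : ∀ j k, j ≠ k → x j ⊓ x k = 0) (n : ℕ) : ∑ k ∈ Finset.range n, x k ≤ e := by
  induction n with
  | zero => simpa using he
  | succ n ih =>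
    rw [Finset.sum_range_succ]
    have h := aux_inf_sum (hx n) x (Finset.range n) hx
      (fun k hk => hd n k (by have := Finset.mem_range.1 hk; omega))
    have h2 := inf_add_sup (x n) (∑ k ∈ Finset.range n, x k)
    rw [h, zero_add, add_comm] at h2
    rw [← h2]
    exact sup_le (hxe n) ih

lemma aux_mono {x : ℕ → E} (hx : ∀ k, 0 ≤ x k) :
    Monotone (fun n => ∑ k ∈ Finset.range n, x k) := by
  apply monotone_nat_of_le_succ
  intro n
  rw [Finset.sum_range_succ]
  exact le_add_of_nonneg_right (hx n)

lemma aux_tail {x : ℕ → E} {B a : E} (ha : 0 ≤ a) (hx : ∀ k, 0 ≤ x k)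
    (hB : IsLUB (Set.range fun n => ∑ k ∈ Finset.range n, x k) B) (n : ℕ)
    (h : ∀ k, n ≤ k → a ⊓ x k = 0) : a ⊓ (B - ∑ k ∈ Finset.range n, x k) = 0 := by
  set S := ∑ k ∈ Finset.range n, x k with hS
  have hSB : S ≤ B := hB.1 ⟨n, rfl⟩
  have key : B ≤ a ⊔ (B - S) - a + S := by
    apply hB.2
    rintro _ ⟨m, rfl⟩
    refine (aux_mono hx (Nat.le_add_left m n)).trans ?_
    have hBm : ∑ k ∈ Finset.range (n + m), x k ≤ B := hB.1 ⟨n + m, rfl⟩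
    simp only
    rw [Finset.sum_range_add] at hBm ⊢
    have h0 := aux_inf_sum ha (fun k => x (n + k)) (Finset.range m) (fun k => hx _)
      (fun k _ => h _ (Nat.le_add_right _ _))
    have h2 := inf_add_sup a (∑ k ∈ Finset.range m, x (n + k))
    rw [h0, zero_add] at h2
    rw [add_comm]
    gcongr
    rw [le_sub_iff_add_le', ← h2]
    apply sup_le_sup_left
    rw [le_sub_iff_add_le']
    exact hBm
  have h2 := inf_add_sup a (B - S)
  apply le_antisymm
  · have : a ⊓ (B - S) = a + (B - S) - a ⊔ (B - S) := by rw [← h2]; abel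
    rw [this, sub_nonpos]
    have := sub_le_sub_right key S
    rw [add_sub_cancel_right, le_sub_iff_add_le'] at this
    exact this
  · exact le_inf ha (sub_nonneg.2 hSB)

end helpers

/-- Let `E` be an atomless Dedekind complete vector lattice, `X` a Banach space,
and `T : E → X` orthogonally additive and laterally-to-norm continuous. If
`0 ≤ e`, `|v n| ≤ e` for all `n ≥ 1` and the `v n` are pairwise disjoint, then
`‖T (v n)‖ → 0`. -/
theorem tendsto_norm_zero_of_disjoint_sequence {E X : Type*}
    [AddCommGroup E] [ConditionallyCompleteLattice E]
    [CovariantClass E E (· + ·) (· ≤ ·)] [Module ℝ E] [PosSMulMono ℝ E]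
    [NormedAddCommGroup X] [NormedSpace ℝ X] [CompleteSpace X]
    (hE : Atomless E) (T : E → X) (hoa : IsOrthAdditive T) (hcont : LatToNormCont T)
    (e : E) (he : 0 ≤ e) (v : ℕ → E)
    (hv : ∀ n : ℕ, 1 ≤ n → |v n| ≤ e)
    (hd : ∀ n m : ℕ, 1 ≤ n → 1 ≤ m → n ≠ m → OrthDisjoint (v n) (v m)) :
    Filter.Tendsto (fun n : ℕ => ‖T (v n)‖) Filter.atTop (nhds 0) := by
  classical
  set w : ℕ → E := fun n => v (n + 1) with hw
  have hwe : ∀ n, |w n| ≤ e := fun n => hv _ (by omega)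
  have hwd : ∀ j k, j ≠ k → |w j| ⊓ |w k| = 0 := fun j k hjk =>
    hd _ _ (by omega) (by omega) (by omega)
  have hpl : ∀ n, (w n)⁺ ≤ |w n| := fun n => by
    rw [← posPart_add_negPart]; exact le_add_of_nonneg_right (negPart_nonneg _)
  have hql : ∀ n, (w n)⁻ ≤ |w n| := fun n => by
    rw [← posPart_add_negPart]; exact le_add_of_nonneg_left (posPart_nonneg _)
  have hp0 : ∀ n, 0 ≤ (w n)⁺ := fun n => posPart_nonneg _
  have hq0 : ∀ n, 0 ≤ (w n)⁻ := fun n => negPart_nonneg _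
  have hpe := aux_sum_le he hp0 (fun n => (hpl n).trans (hwe n))
    (fun j k hjk => aux_inf_mono (hp0 j) (hp0 k) (hpl j) (hpl k) (hwd j k hjk))
  have hqe := aux_sum_le he hq0 (fun n => (hql n).trans (hwe n))
    (fun j k hjk => aux_inf_mono (hq0 j) (hq0 k) (hql j) (hql k) (hwd j k hjk))
  obtain ⟨P, hP⟩ : ∃ P, IsLUB (Set.range fun n => ∑ k ∈ Finset.range n, (w k)⁺) P :=
    ⟨_, isLUB_csSup (Set.range_nonempty _) ⟨e, by rintro _ ⟨n, rfl⟩; exact hpe n⟩⟩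
  obtain ⟨Q, hQ⟩ : ∃ Q, IsLUB (Set.range fun n => ∑ k ∈ Finset.range n, (w k)⁻) Q :=
    ⟨_, isLUB_csSup (Set.range_nonempty _) ⟨e, by rintro _ ⟨n, rfl⟩; exact hqe n⟩⟩
  set p : ℕ → E := fun n => ∑ k ∈ Finset.range n, (w k)⁺ with hp
  set q : ℕ → E := fun n => ∑ k ∈ Finset.range n, (w k)⁻ with hq
  have hpm : Monotone p := aux_mono hp0
  have hqm : Monotone q := aux_mono hq0
  have hpP : ∀ n, p n ≤ P := fun n => hP.1 ⟨n, rfl⟩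
  have hqQ : ∀ n, q n ≤ Q := fun n => hQ.1 ⟨n, rfl⟩
  set f : ℕ → E := fun n => (P - p n) + (Q - q n) with hf
  have hf0 : ∀ n, 0 ≤ f n := fun n =>
    add_nonneg (sub_nonneg.2 (hpP n)) (sub_nonneg.2 (hqQ n))
  set s : ℕ → E := fun n => p n - q n with hs
  have habs : ∀ a b : E, 0 ≤ a → 0 ≤ b → |a - b| ≤ a + b := by
    intro a b ha hb
    rw [abs_le']
    constructor
    · rw [sub_eq_add_neg]; gcongr; exact (neg_nonpos.2 hb).trans hb
    · rw [neg_sub, sub_eq_add_neg, add_comm]; gcongr; exact (neg_nonpos.2 ha).trans ha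
  have hsabs : ∀ n, |s n| ≤ ∑ k ∈ Finset.range n, |w k| := by
    intro n
    refine (habs _ _ (Finset.sum_nonneg fun k _ => hp0 k)
      (Finset.sum_nonneg fun k _ => hq0 k)).trans (le_of_eq ?_)
    rw [← Finset.sum_add_distrib]
    exact Finset.sum_congr rfl fun k _ => posPart_add_negPart _
  have hsf : ∀ n, |s n| ⊓ f n = 0 := by
    intro n
    refine aux_inf_mono (abs_nonneg _) (hf0 n) (hsabs n) le_rfl ?_
    rw [inf_comm]
    refine aux_inf_sum (hf0 n) _ _ (fun k => abs_nonneg _) ?_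
    intro j hj
    have hj' := Finset.mem_range.1 hj
    rw [inf_comm]
    refine aux_inf_add (abs_nonneg _) (sub_nonneg.2 (hpP n)) (sub_nonneg.2 (hqQ n)) ?_ ?_
    · exact aux_tail (abs_nonneg _) hp0 hP n fun k hk =>
        aux_inf_mono (abs_nonneg _) (hp0 k) le_rfl (hpl k) (hwd j k (by omega))
    · exact aux_tail (abs_nonneg _) hq0 hQ n fun k hk =>
        aux_inf_mono (abs_nonneg _) (hq0 k) le_rfl (hql k) (hwd j k (by omega))
  have hVf : ∀ n, |(P - Q) - s n| ≤ f n := by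
    intro n
    have : (P - Q) - s n = (P - p n) - (Q - q n) := by simp only [hs]; abel
    rw [this]
    exact habs _ _ (sub_nonneg.2 (hpP n)) (sub_nonneg.2 (hqQ n))
  have hfr : ∀ a b : ℕ, a ≤ b → Fragment (s a) (s b) := by
    intro a b hab
    refine aux_inf_mono (abs_nonneg _) (abs_nonneg _) le_rfl ?_ (hsf a)
    have : s b - s a = (p b - p a) - (q b - q a) := by simp only [hs]; abel
    rw [this]
    refine (habs _ _ (sub_nonneg.2 (hpm hab)) (sub_nonneg.2 (hqm hab))).trans ?_
    exact add_le_add (sub_le_sub_right (hpP b) _) (sub_le_sub_right (hqQ b) _)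
  have hlat : LaterallyConvTo s (P - Q) := by
    refine ⟨hfr, fun a => aux_inf_mono (abs_nonneg _) (abs_nonneg _) le_rfl (hVf a) (hsf a), ?_⟩
    refine ⟨ℕ, inferInstance, f, inferInstance, inferInstance, ?_, ⟨?_, ?_⟩, ?_⟩
    · intro a b hab
      exact add_le_add (sub_le_sub_left (hpm hab) _) (sub_le_sub_left (hqm hab) _)
    · rintro _ ⟨n, rfl⟩; exact hf0 n
    · intro c hc
      have h1 : ∀ n m, p n + q m ≤ P + Q - c := by
        intro n m
        have h2 : c ≤ f (max n m) := hc ⟨_, rfl⟩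
        refine (add_le_add (hpm (le_max_left n m)) (hqm (le_max_right n m))).trans ?_
        rw [le_sub_comm]
        refine h2.trans (le_of_eq ?_)
        simp only [hf]; abel
      have h3 : ∀ m, P ≤ P + Q - c - q m := fun m => hP.2 (by
        rintro _ ⟨n, rfl⟩
        exact le_sub_iff_add_le.2 (h1 n m))
      have h4 : Q ≤ P + Q - c - P := hQ.2 (by
        rintro _ ⟨m, rfl⟩
        exact le_sub_comm.1 (h3 m))
      have h5 : P + Q - c - P = Q - c := by abel
      rw [h5] at h4
      exact (le_sub_self_iff Q).1 h4
    · intro b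
      refine ⟨b, fun a hab => ?_⟩
      rw [abs_sub_comm]
      refine (hVf a).trans ?_
      exact add_le_add (sub_le_sub_left (hpm hab) _) (sub_le_sub_left (hqm hab) _)
  have hT := hcont ℕ inferInstance inferInstance inferInstance s (P - Q) hlat
  have hstep : ∀ n, T (s (n + 1)) - T (s n) = T (v (n + 1)) := by
    intro n
    have h1 : s (n + 1) - s n = v (n + 1) := by
      have h2 : (w n)⁺ - (w n)⁻ = w n := posPart_sub_negPart _
      have h3 : s (n + 1) - s n = (w n)⁺ - (w n)⁻ := by
        simp only [hs, hp, hq, Finset.sum_range_succ]; abel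
      rw [h3, h2]
    have h4 := hoa _ _ (hfr n (n + 1) (by omega))
    rw [h1] at h4
    rw [← h4.symm.trans (congrArg T (by rw [← h1]; abel)), add_sub_cancel_left]
  have hdiff := ((Filter.tendsto_add_atTop_iff_nat 1).2 hT).sub hT
  rw [sub_self] at hdiff
  simp only [hstep] at hdiff
  have hfin := (Filter.tendsto_add_atTop_iff_nat (f := fun n => T (v n)) 1).1 hdiff
  simpa using hfin.norm
end

section
/- Let E be an atomless Dedekind complete vector lattice, F a finite-dimensional real normed space, T : E → F an orthogonally additive, laterally-to-norm continuous operator, v ∈ E, and (v_n)_{n≥1} a disjoint tree on v, i.e., v₁ = v and v_n = v_{2n} + v_{2n+1} with v_{2n} ⊥ v_{2n+1} for every n ≥ 1. If ‖T(v_{2n})‖ = ‖T(v_{2n+1})‖ for every n ≥ 1, then lim_{m→∞} γ_m = 0, where γ_m = max_{2^m ≤ i < 2^{m+1}} ‖T(v_i)‖. -/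
section helpers
variable {E : Type*} [AddCommGroup E] [Lattice E] [CovariantClass E E (· + ·) (· ≤ ·)]

theorem tt_inf_add_le {a b c : E} (ha : 0 ≤ a) (hb : 0 ≤ b) (hc : 0 ≤ c) :
    a ⊓ (b + c) ≤ a ⊓ b + a ⊓ c := by
  have h1 : a ⊓ b + a ⊓ c = (a + a) ⊓ (a + c) ⊓ ((b + a) ⊓ (b + c)) := by
    rw [inf_add, add_inf, add_inf]
  rw [h1]
  refine le_inf (le_inf ?_ ?_) (le_inf ?_ inf_le_right)
  · exact inf_le_left.trans (le_add_of_nonneg_right ha)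
  · exact inf_le_left.trans (le_add_of_nonneg_right hc)
  · exact inf_le_left.trans (le_add_of_nonneg_left hb)

theorem tt_orth_symm {x y : E} (h : OrthDisjoint x y) : OrthDisjoint y x := by
  unfold OrthDisjoint at *
  rwa [inf_comm]

theorem tt_orth_mono {x y z : E} (h : OrthDisjoint x y) (hz : |z| ≤ |y|) :
    OrthDisjoint x z := by
  unfold OrthDisjoint at *
  exact le_antisymm (h ▸ inf_le_inf_left _ hz) (le_inf (abs_nonneg _) (abs_nonneg _))

theorem tt_abs_le {x y : E} (h : OrthDisjoint x y) : |x| ≤ |x + y| := by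
  unfold OrthDisjoint at h
  have h1 : |x| ≤ |x + y| + |y| := by
    have := abs_add_le (x + y) (-y)
    rwa [abs_neg, add_neg_cancel_right] at this
  calc |x| = |x| ⊓ (|x + y| + |y|) := (inf_eq_left.2 h1).symm
    _ ≤ |x| ⊓ |x + y| + |x| ⊓ |y| := tt_inf_add_le (abs_nonneg _) (abs_nonneg _) (abs_nonneg _)
    _ ≤ |x + y| := by rw [h, add_zero]; exact inf_le_right

theorem tt_orth_zero (x : E) : OrthDisjoint x 0 := by
  unfold OrthDisjoint
  rw [abs_zero]
  exact inf_eq_right.2 (abs_nonneg x)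

theorem tt_orth_add {x y z : E} (hy : OrthDisjoint x y) (hz : OrthDisjoint x z) :
    OrthDisjoint x (y + z) := by
  unfold OrthDisjoint at *
  refine le_antisymm ?_ (le_inf (abs_nonneg _) (abs_nonneg _))
  calc |x| ⊓ |y + z| ≤ |x| ⊓ (|y| + |z|) := inf_le_inf_left _ (abs_add_le _ _)
    _ ≤ |x| ⊓ |y| + |x| ⊓ |z| := tt_inf_add_le (abs_nonneg _) (abs_nonneg _) (abs_nonneg _)
    _ = 0 := by rw [hy, hz, add_zero]

theorem tt_orth_sum {ι : Type*} (s : Finset ι) (x : E) (y : ι → E)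
    (h : ∀ i ∈ s, OrthDisjoint x (y i)) : OrthDisjoint x (∑ i ∈ s, y i) := by
  classical
  induction s using Finset.induction_on with
  | empty => simpa using tt_orth_zero x
  | insert a s ha ih =>
    rw [Finset.sum_insert ha]
    exact tt_orth_add (h a (by simp)) (ih fun i hi => h i (by simp [hi]))

theorem tt_sum_abs_le {x : ℕ → E} {w : E} (hw : 0 ≤ w) (hx : ∀ k, |x k| ≤ w)
    (hd : ∀ m n, m < n → OrthDisjoint (x m) (x n)) (n : ℕ) :
    ∑ k ∈ Finset.range n, |x k| ≤ w := by
  induction n with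
  | zero => simpa using hw
  | succ n ih =>
    rw [Finset.sum_range_succ]
    have h0 : 0 ≤ ∑ k ∈ Finset.range n, |x k| := by
      clear ih
      induction n with
      | zero => simp
      | succ n ih => rw [Finset.sum_range_succ]; exact add_nonneg ih (abs_nonneg _)
    have h : OrthDisjoint (x n) (∑ k ∈ Finset.range n, |x k|) := by
      apply tt_orth_sum
      intro i hi
      exact tt_orth_mono (tt_orth_symm (hd i n (Finset.mem_range.1 hi))) (by rw [abs_abs])
    unfold OrthDisjoint at h
    rw [abs_of_nonneg h0] at h
    rw [← inf_add_sup, inf_comm, h, zero_add]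
    exact sup_le ih (hx n)

end helpers

theorem tt_tendsto_zero {E F : Type*}
    [AddCommGroup E] [ConditionallyCompleteLattice E]
    [CovariantClass E E (· + ·) (· ≤ ·)] [NormedAddCommGroup F]
    (T : E → F) (hoa : IsOrthAdditive T) (hcont : LatToNormCont T)
    {x : ℕ → E} {w : E} (hw : 0 ≤ w) (hx : ∀ k, |x k| ≤ w)
    (hd : ∀ m n, m < n → OrthDisjoint (x m) (x n)) :
    Filter.Tendsto (fun n => T (x n)) Filter.atTop (nhds 0) := by
  set s : ℕ → E := fun n => ∑ k ∈ Finset.range n, x k with hs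
  set P : ℕ → E := fun n => ∑ k ∈ Finset.range n, (x k)⁺ with hP
  set Q : ℕ → E := fun n => ∑ k ∈ Finset.range n, (x k)⁻ with hQ
  have hsPQ : ∀ n, s n = P n - Q n := by
    intro n
    simp only [hs, hP, hQ, ← Finset.sum_sub_distrib, posPart_sub_negPart]
  have hPm : Monotone P := monotone_nat_of_le_succ fun n => by
    simp only [hP, Finset.sum_range_succ]
    exact le_add_of_nonneg_right (posPart_nonneg _)
  have hQm : Monotone Q := monotone_nat_of_le_succ fun n => by
    simp only [hQ, Finset.sum_range_succ]
    exact le_add_of_nonneg_right (negPart_nonneg _)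
  have hP0 : ∀ n, 0 ≤ P n := fun n => by
    have := hPm (Nat.zero_le n)
    simpa [hP] using this
  have hQ0 : ∀ n, 0 ≤ Q n := fun n => by
    have := hQm (Nat.zero_le n)
    simpa [hQ] using this
  have hPQ : ∀ n, P n + Q n ≤ w := by
    intro n
    have := tt_sum_abs_le hw hx hd n
    simpa only [hP, hQ, ← Finset.sum_add_distrib, posPart_add_negPart] using this
  have hPb : IsLUB (Set.range P) (sSup (Set.range P)) :=
    isLUB_csSup (Set.range_nonempty _) ⟨w, by
      rintro _ ⟨n, rfl⟩; exact (le_add_of_nonneg_right (hQ0 n)).trans (hPQ n)⟩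
  have hQb : IsLUB (Set.range Q) (sSup (Set.range Q)) :=
    isLUB_csSup (Set.range_nonempty _) ⟨w, by
      rintro _ ⟨n, rfl⟩; exact (le_add_of_nonneg_left (hP0 n)).trans (hPQ n)⟩
  set p := sSup (Set.range P)
  set q := sSup (Set.range Q)
  have hPp : ∀ n, P n ≤ p := fun n => hPb.1 ⟨n, rfl⟩
  have hQq : ∀ n, Q n ≤ q := fun n => hQb.1 ⟨n, rfl⟩
  set f : ℕ → E := fun n => (p - P n) + (q - Q n) with hf
  have hfa : ∀ m n, m ≤ n → f n ≤ f m := fun m n h =>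
    add_le_add (sub_le_sub_left (hPm h) _) (sub_le_sub_left (hQm h) _)
  have hfg : IsGLB (Set.range f) 0 := by
    constructor
    · rintro _ ⟨n, rfl⟩
      exact add_nonneg (sub_nonneg.2 (hPp n)) (sub_nonneg.2 (hQq n))
    · intro z hz
      have h1 : ∀ m n, z ≤ (p - P m) + (q - Q n) := by
        intro m n
        refine (hz ⟨max m n, rfl⟩).trans ?_
        exact add_le_add (sub_le_sub_left (hPm (le_max_left _ _)) _)
          (sub_le_sub_left (hQm (le_max_right _ _)) _)
      have h2 : ∀ n, p ≤ p + (q - Q n) - z := by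
        intro n
        apply hPb.2
        rintro _ ⟨m, rfl⟩
        have := h1 m n
        rw [le_sub_iff_add_le]
        calc P m + z ≤ P m + ((p - P m) + (q - Q n)) := by gcongr
          _ = _ := by abel
      have h3 : q ≤ q - z := by
        apply hQb.2
        rintro _ ⟨n, rfl⟩
        have := h2 n
        rw [le_sub_iff_add_le] at this ⊢
        have h4 : z ≤ q - Q n := by simpa using this
        calc Q n + z ≤ Q n + (q - Q n) := by gcongr
          _ = q := by abel
      simpa using h3
  have hsf : ∀ n, |s n - (p - q)| ≤ f n := by
    intro n
    have : s n - (p - q) = -(p - P n) + (q - Q n) := by rw [hsPQ]; abel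
    rw [this]
    refine (abs_add_le _ _).trans ?_
    rw [abs_neg, abs_of_nonneg (sub_nonneg.2 (hPp n)), abs_of_nonneg (sub_nonneg.2 (hQq n))]
  have hfrag : ∀ a b, a ≤ b → Fragment (s a) (s b) := by
    intro a b hab
    unfold Fragment
    have : s b - s a = ∑ k ∈ Finset.Ico a b, x k := (Finset.sum_Ico_eq_sub _ hab).symm
    rw [this]
    apply tt_orth_sum
    intro i hi
    apply tt_orth_symm
    apply tt_orth_sum
    intro j hj
    exact tt_orth_symm (hd j i ((Finset.mem_range.1 hj).trans_le (Finset.mem_Ico.1 hi).1))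
  have hlat : LaterallyConvTo s (p - q) := by
    refine ⟨hfrag, ?_, ℕ, inferInstance, f, inferInstance, inferInstance, hfa, hfg, ?_⟩
    · intro a
      unfold Fragment OrthDisjoint
      refine le_antisymm (hfg.2 ?_) (le_inf (abs_nonneg _) (abs_nonneg _))
      rintro _ ⟨n, rfl⟩
      refine le_trans ?_ (hfa n (max a n) (le_max_right _ _))
      have h1 := hfrag a (max a n) (le_max_left _ _)
      unfold Fragment OrthDisjoint at h1
      have h2 : |p - q - s a| ≤ |s (max a n) - s a| + |s (max a n) - (p - q)| := by
        rw [abs_sub_comm (s (max a n)) (p - q)]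
        refine le_trans (le_of_eq ?_) (abs_add_le _ _)
        congr 1; abel
      calc |s a| ⊓ |p - q - s a| ≤ |s a| ⊓ (|s (max a n) - s a| + |s (max a n) - (p - q)|) :=
            inf_le_inf_left _ h2
        _ ≤ _ := tt_inf_add_le (abs_nonneg _) (abs_nonneg _) (abs_nonneg _)
        _ ≤ f (max a n) := by rw [h1, zero_add]; exact inf_le_right.trans (hsf _)
    · intro b
      exact ⟨b, fun a h => (hsf a).trans (hfa _ _ h)⟩
  have ht := hcont ℕ inferInstance inferInstance inferInstance s (p - q) hlat
  have ht' := ht.comp (Filter.tendsto_add_atTop_nat 1)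
  have := ht'.sub ht
  rw [sub_self] at this
  refine this.congr fun n => ?_
  have h1 : s (n + 1) = s n + x n := Finset.sum_range_succ _ _
  have h2 : OrthDisjoint (s n) (x n) := by
    apply tt_orth_symm
    apply tt_orth_sum
    intro j hj
    exact tt_orth_symm (hd j n (Finset.mem_range.1 hj))
  simp only [Function.comp]
  rw [h1, hoa _ _ h2, add_sub_cancel_left]

/-- Ancestor relation in the binary tree. -/
def ttAnc (i j : ℕ) : Prop := ∃ d, j / 2 ^ d = i

theorem ttAnc_trans {i j k : ℕ} (h : ttAnc i j) (h' : ttAnc j k) : ttAnc i k := by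
  obtain ⟨d, rfl⟩ := h
  obtain ⟨e, rfl⟩ := h'
  exact ⟨e + d, by rw [pow_add, Nat.div_div_eq_div_mul]⟩

theorem ttAnc_half {i j : ℕ} (h : ttAnc i j) (hij : i < j) : ttAnc i (j / 2) := by
  obtain ⟨d, rfl⟩ := h
  cases d with
  | zero => simp at hij
  | succ d => exact ⟨d, by rw [Nat.div_div_eq_div_mul, pow_succ, mul_comm]⟩

theorem ttAnc_of_half {i j : ℕ} (h : ttAnc i (j / 2)) : ttAnc i j :=
  ttAnc_trans h ⟨1, by simp⟩

/-- Sibling in the binary tree. -/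
def ttSib (i : ℕ) : ℕ := if i % 2 = 0 then i + 1 else i - 1

section tree
variable {E : Type*} [AddCommGroup E] [Lattice E] [CovariantClass E E (· + ·) (· ≤ ·)]
  {t : ℕ → E}

theorem tt_half_le (htree : ∀ n : ℕ, 1 ≤ n →
      t n = t (2 * n) + t (2 * n + 1) ∧ OrthDisjoint (t (2 * n)) (t (2 * n + 1)))
    {i : ℕ} (hi : 2 ≤ i) : |t i| ≤ |t (i / 2)| := by
  obtain ⟨h1, h2⟩ := htree (i / 2) (by omega)
  rcases Nat.mod_two_eq_zero_or_one i with h | h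
  · have e : 2 * (i / 2) = i := by omega
    rw [h1]
    rw [e] at h2 ⊢
    exact tt_abs_le h2
  · have e : 2 * (i / 2) + 1 = i := by omega
    rw [h1]
    rw [e] at h2 ⊢
    rw [add_comm]
    exact tt_abs_le (tt_orth_symm h2)

theorem tt_anc_le (htree : ∀ n : ℕ, 1 ≤ n →
      t n = t (2 * n) + t (2 * n + 1) ∧ OrthDisjoint (t (2 * n)) (t (2 * n + 1)))
    {i j : ℕ} (hi : 1 ≤ i) (h : ttAnc i j) : |t j| ≤ |t i| := by
  obtain ⟨d, hd⟩ := h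
  induction d generalizing j with
  | zero => simp at hd; rw [hd]
  | succ d ih =>
    have e : j / 2 / 2 ^ d = i := by rw [Nat.div_div_eq_div_mul, ← hd, pow_succ, mul_comm]
    have h2 : 2 ≤ j := by
      by_contra hc
      have : j / 2 = 0 := by omega
      rw [this] at e
      simp at e
      omega
    exact (tt_half_le htree h2).trans (ih e)

theorem tt_anc_one {j : ℕ} (hj : 1 ≤ j) : ttAnc 1 j := by
  induction j using Nat.strong_induction_on with
  | _ j ih =>
    rcases Nat.lt_or_ge j 2 with h | h
    · exact ⟨0, by simp; omega⟩
    · exact ttAnc_of_half (ih (j / 2) (by omega) (by omega))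

theorem tt_sib_orth (htree : ∀ n : ℕ, 1 ≤ n →
      t n = t (2 * n) + t (2 * n + 1) ∧ OrthDisjoint (t (2 * n)) (t (2 * n + 1)))
    {i : ℕ} (hi : 2 ≤ i) : OrthDisjoint (t i) (t (ttSib i)) := by
  obtain ⟨h1, h2⟩ := htree (i / 2) (by omega)
  unfold ttSib
  split_ifs with h
  · have e : 2 * (i / 2) = i := by omega
    rwa [e] at h2
  · have e : 2 * (i / 2) = i - 1 := by omega
    have e' : i - 1 + 1 = i := by omega
    rw [e, e'] at h2
    exact tt_orth_symm h2

theorem tt_disj (htree : ∀ n : ℕ, 1 ≤ n →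
      t n = t (2 * n) + t (2 * n + 1) ∧ OrthDisjoint (t (2 * n)) (t (2 * n + 1)))
    {i j : ℕ} (hi : 1 ≤ i) (hij : i < j) (h : ¬ ttAnc i j) : OrthDisjoint (t i) (t j) := by
  induction j using Nat.strong_induction_on generalizing i with
  | _ j ih =>
    have h' : ¬ ttAnc i (j / 2) := fun hc => h (ttAnc_of_half hc)
    have hne : i ≠ j / 2 := fun e => h' ⟨0, by simp [e]⟩
    have hle := tt_half_le htree (i := j) (by omega)
    rcases lt_or_gt_of_ne hne with hl | hl
    · exact tt_orth_mono (ih (j / 2) (by omega) hi hl h') hle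
    · by_cases hr : ttAnc (j / 2) i
      · have h1 := ttAnc_half hr hl
        have h2 : j / 2 ≤ i / 2 := by
          obtain ⟨d, hd⟩ := h1
          rw [← hd]; exact Nat.div_le_self _ _
        have h3 : ttSib i = j := by
          unfold ttSib
          rw [if_pos (by omega)]; omega
        rw [← h3]
        exact tt_sib_orth htree (by omega)
      · have := ih i hij (i := j / 2) (by omega) hl hr
        exact tt_orth_mono (tt_orth_symm this) hle

end tree

/-- Let `(t n)` be a disjoint tree on `v` (with `t 1 = v` and
`t n = t (2n) + t (2n+1)`, `t (2n) ⊥ t (2n+1)` for `n ≥ 1`). If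
`‖T (t (2n))‖ = ‖T (t (2n+1))‖` for all `n ≥ 1`, then
`γ m = max_{2^m ≤ i < 2^(m+1)} ‖T (t i)‖` tends to `0`. -/
theorem tendsto_tree_max_zero {E F : Type*}
    [AddCommGroup E] [ConditionallyCompleteLattice E]
    [CovariantClass E E (· + ·) (· ≤ ·)] [Module ℝ E] [PosSMulMono ℝ E]
    [NormedAddCommGroup F] [NormedSpace ℝ F] [FiniteDimensional ℝ F]
    (hE : Atomless E) (T : E → F) (hoa : IsOrthAdditive T) (hcont : LatToNormCont T)
    (v : E) (t : ℕ → E) (ht1 : t 1 = v)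
    (htree : ∀ n : ℕ, 1 ≤ n →
      t n = t (2 * n) + t (2 * n + 1) ∧ OrthDisjoint (t (2 * n)) (t (2 * n + 1)))
    (hnorm : ∀ n : ℕ, 1 ≤ n → ‖T (t (2 * n))‖ = ‖T (t (2 * n + 1))‖) :
    Filter.Tendsto
      (fun m : ℕ => (Finset.Ico (2 ^ m) (2 ^ (m + 1))).sup'
        (Finset.nonempty_Ico.mpr (Nat.pow_lt_pow_right one_lt_two m.lt_succ_self))
        (fun i => ‖T (t i)‖))
      Filter.atTop (nhds 0) := by
  have hsibnorm : ∀ i, 2 ≤ i → ‖T (t (ttSib i))‖ = ‖T (t i)‖ := by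
    intro i hi
    have h2 := hnorm (i / 2) (by omega)
    unfold ttSib
    split_ifs with h
    · have e : 2 * (i / 2) = i := by omega
      rw [e] at h2
      exact h2.symm
    · have e : 2 * (i / 2) = i - 1 := by omega
      have e' : i - 1 + 1 = i := by omega
      rwa [e, e'] at h2
  have hbd : ∀ i, 1 ≤ i → |t i| ≤ |v| := fun i hi => by
    rw [← ht1]; exact tt_anc_le htree le_rfl (tt_anc_one hi)
  -- no pairwise disjoint sequence of nodes with large values
  have key : ∀ ε : ℝ, 0 < ε → ∀ a : ℕ → ℕ, (∀ n, 1 ≤ a n) → (∀ n, ε ≤ ‖T (t (a n))‖) →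
      (∀ m n, m < n → OrthDisjoint (t (a m)) (t (a n))) → False := by
    intro ε hε a ha hT hd
    have h := tt_tendsto_zero T hoa hcont (x := fun n => t (a n)) (abs_nonneg v)
      (fun k => hbd _ (ha k)) hd
    have h2 := h.norm
    rw [norm_zero] at h2
    exact absurd (ge_of_tendsto' h2 hT) (not_le.2 hε)
  have hfin : ∀ ε : ℝ, 0 < ε → {i : ℕ | 2 ≤ i ∧ ε ≤ ‖T (t i)‖}.Finite := by
    intro ε hε
    by_contra hinf
    have hinf : {i : ℕ | 2 ≤ i ∧ ε ≤ ‖T (t i)‖}.Infinite := hinf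
    set f := Nat.nth (fun i => 2 ≤ i ∧ ε ≤ ‖T (t i)‖)
    have hfm : StrictMono f := Nat.nth_strictMono hinf
    have hfS : ∀ n, 2 ≤ f n ∧ ε ≤ ‖T (t (f n))‖ := fun n => Nat.nth_mem_of_infinite hinf n
    haveI : IsTrans ℕ ttAnc := ⟨fun _ _ _ h h' => ttAnc_trans h h'⟩
    obtain ⟨g, hg | hg⟩ := exists_increasing_or_nonincreasing_subseq ttAnc f
    · refine key ε hε (fun n => ttSib (f (g n))) ?_ ?_ ?_
      · intro n
        have := (hfS (g n)).1
        simp only [ttSib]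
        split_ifs <;> omega
      · intro n
        rw [hsibnorm _ (hfS (g n)).1]
        exact (hfS (g n)).2
      · intro m n hmn
        have hlt : f (g m) < f (g n) := hfm (g.strictMono hmn)
        have h1 := ttAnc_half (hg m n hmn) hlt
        have h2n := (hfS (g n)).1
        have h2m := (hfS (g m)).1
        have h3 := tt_anc_le htree (by omega) h1
        have h4 : 2 ≤ ttSib (f (g n)) ∧ ttSib (f (g n)) / 2 = f (g n) / 2 := by
          unfold ttSib
          split_ifs <;> omega
        have h5 := tt_half_le htree h4.1
        rw [h4.2] at h5
        exact tt_orth_mono (tt_orth_symm (tt_sib_orth htree h2m)) (h5.trans h3)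
    · refine key ε hε (fun n => f (g n)) ?_ ?_ ?_
      · intro n
        have := (hfS (g n)).1
        omega
      · exact fun n => (hfS (g n)).2
      · intro m n hmn
        have h2m := (hfS (g m)).1
        exact tt_disj htree (by omega) (hfm (g.strictMono hmn)) (hg m n hmn)
  rw [Metric.tendsto_atTop]
  intro ε hε
  obtain ⟨N, hN⟩ := (hfin ε hε).bddAbove
  refine ⟨N + 1, fun m hm => ?_⟩
  have hpow : m < 2 ^ m := Nat.lt_two_pow_self
  rw [Real.dist_eq, sub_zero, abs_of_nonneg]
  · rw [Finset.sup'_lt_iff]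
    intro i hi
    by_contra hc
    have h1 := (Finset.mem_Ico.1 hi).1
    have h2 : 2 ^ 1 ≤ 2 ^ m := Nat.pow_le_pow_right (by norm_num) (by omega)
    have := hN (show i ∈ {i : ℕ | 2 ≤ i ∧ ε ≤ ‖T (t i)‖} from ⟨by omega, not_lt.1 hc⟩)
    omega
  · refine (norm_nonneg (T (t (2 ^ m)))).trans ?_
    exact Finset.le_sup' (fun i => ‖T (t i)‖)
      (Finset.mem_Ico.2 ⟨le_rfl, Nat.pow_lt_pow_right one_lt_two m.lt_succ_self⟩)
end

section
/- Let E and F be vector lattices with F Dedekind complete and T : E → F an orthogonally additive order bounded operator. Then for every f ∈ E the set {T(g) : g ⊑ f} has a supremum and the set {T(g) : g ⊑ f} has an infimum in F; defining T⁺(f) = sup{T(g) : g ⊑ f} and T⁻(f) = −inf{T(g) : g ⊑ f}, one has |T(f)| ≤ T⁺(f) + T⁻(f) for every f ∈ E. -/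
/-- For an orthogonally additive order bounded operator `T : E → F` into a
Dedekind complete vector lattice, the sets `{T g : g ⊑ f}` have suprema and
infima, and with `T⁺ f = sup {T g : g ⊑ f}`, `T⁻ f = - inf {T g : g ⊑ f}` one
has `|T f| ≤ T⁺ f + T⁻ f` (that is, `|T f| ≤ |T| f`). -/
theorem abs_le_posPart_add_negPart {E F : Type*}
    [AddCommGroup E] [Lattice E] [CovariantClass E E (· + ·) (· ≤ ·)]
    [Module ℝ E] [PosSMulMono ℝ E]
    [AddCommGroup F] [ConditionallyCompleteLattice F]
    [CovariantClass F F (· + ·) (· ≤ ·)] [Module ℝ F] [PosSMulMono ℝ F]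
    (T : E → F) (hT : IsOrthAdditive T) (hTob : IsOrderBounded T) :
    ∃ Tp Tm : E → F,
      (∀ f : E, IsLUB {y : F | ∃ g : E, Fragment g f ∧ y = T g} (Tp f)) ∧
      (∀ f : E, IsGLB {y : F | ∃ g : E, Fragment g f ∧ y = T g} (-(Tm f))) ∧
      ∀ f : E, |T f| ≤ Tp f + Tm f := by
  have hE : ∀ x y z : E, x ≤ y → z + x ≤ z + y := fun x y z h => CovariantClass.elim z h
  have hF : ∀ x y z : F, x ≤ y → z + x ≤ z + y := fun x y z h => CovariantClass.elim z h
  have : IsOrderedAddMonoid E :=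
    { add_le_add_left := fun a b h c => by
        rw [add_comm a c, add_comm b c]; exact hE _ _ _ h }
  have : IsOrderedAddMonoid F :=
    { add_le_add_left := fun a b h c => by
        rw [add_comm a c, add_comm b c]; exact hF _ _ _ h }
  have hT0 : T 0 = 0 := by
    have h := hT 0 0 (by simp [OrthDisjoint])
    simpa using h
  have habs : ∀ g f : E, Fragment g f → |g| ≤ |f| := by
    intro g f h
    have h0 : |g| ⊓ |f - g| = 0 := h
    have h1 : |g| ≤ |f| + |f - g| := by
      have h2 := abs_add_le f (-(f - g))
      rw [abs_neg] at h2
      have h3 : f + -(f - g) = g := by abel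
      rwa [h3] at h2
    have h4 : |g| - |f| ≤ |g| ⊓ |f - g| :=
      le_inf (sub_le_self _ (abs_nonneg f)) (sub_le_iff_le_add'.mpr h1)
    rw [h0] at h4
    exact sub_nonpos.mp h4
  have hself : ∀ f : E, T f ∈ {y : F | ∃ g : E, Fragment g f ∧ y = T g} := fun f =>
    ⟨f, by simp [Fragment, OrthDisjoint], rfl⟩
  have hzero : ∀ f : E, (0 : F) ∈ {y : F | ∃ g : E, Fragment g f ∧ y = T g} := fun f =>
    ⟨0, by simp [Fragment, OrthDisjoint], hT0.symm⟩
  have hb : ∀ f : E, BddBelow {y : F | ∃ g : E, Fragment g f ∧ y = T g} ∧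
      BddAbove {y : F | ∃ g : E, Fragment g f ∧ y = T g} := by
    intro f
    have hsub : {y : F | ∃ g : E, Fragment g f ∧ y = T g} ⊆ T '' Set.Icc (-|f|) |f| := by
      rintro y ⟨g, hg, rfl⟩
      exact ⟨g, ⟨neg_le.mp ((neg_le_abs g).trans (habs g f hg)), (le_abs_self g).trans (habs g f hg)⟩, rfl⟩
    have h := hTob (Set.Icc (-|f|) |f|) bddBelow_Icc bddAbove_Icc
    exact ⟨h.1.mono hsub, h.2.mono hsub⟩
  have hlub : ∀ f : E, IsLUB {y : F | ∃ g : E, Fragment g f ∧ y = T g}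
      (sSup {y : F | ∃ g : E, Fragment g f ∧ y = T g}) := fun f =>
    isLUB_csSup ⟨_, hself f⟩ (hb f).2
  have hglb : ∀ f : E, IsGLB {y : F | ∃ g : E, Fragment g f ∧ y = T g}
      (sInf {y : F | ∃ g : E, Fragment g f ∧ y = T g}) := fun f =>
    isGLB_csInf ⟨_, hself f⟩ (hb f).1
  refine ⟨fun f => sSup {y : F | ∃ g : E, Fragment g f ∧ y = T g},
    fun f => -sInf {y : F | ∃ g : E, Fragment g f ∧ y = T g}, hlub, ?_, ?_⟩
  · intro f
    rw [neg_neg]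
    exact hglb f
  · intro f
    have p1 := (hlub f).1 (hself f)
    have p2 := (hlub f).1 (hzero f)
    have q1 := neg_le_neg ((hglb f).1 (hself f))
    have q2 := neg_le_neg ((hglb f).1 (hzero f))
    rw [neg_zero] at q2
    refine abs_le'.mpr ⟨?_, ?_⟩
    · simpa using add_le_add p1 q2
    · simpa using add_le_add p2 q1
end

section
/- Let E and F be vector lattices with F Dedekind complete, and let S, T : E → F be even orthogonally additive order bounded operators. Then their join and meet in the lattice of abstract Uryson operators are even; explicitly, the operators f ↦ sup{T(g) + S(h) : f = g + h, g ⊥ h} and f ↦ inf{T(g) + S(h) : f = g + h, g ⊥ h} satisfy R(−f) = R(f) for all f ∈ E. -/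
/-- If `S, T : E → F` are even orthogonally additive order bounded operators
into a Dedekind complete vector lattice, then their join
`f ↦ sup {T g + S h : f = g + h, g ⊥ h}` and meet
`f ↦ inf {T g + S h : f = g + h, g ⊥ h}` are even operators. -/
theorem join_meet_of_even_is_even {E F : Type*}
    [AddCommGroup E] [Lattice E] [CovariantClass E E (· + ·) (· ≤ ·)]
    [Module ℝ E] [PosSMulMono ℝ E]
    [AddCommGroup F] [ConditionallyCompleteLattice F]
    [CovariantClass F F (· + ·) (· ≤ ·)] [Module ℝ F] [PosSMulMono ℝ F]
    (T S : E → F) (hT : IsOrthAdditive T) (hTob : IsOrderBounded T)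
    (hS : IsOrthAdditive S) (hSob : IsOrderBounded S)
    (hTev : ∀ x : E, T (-x) = T x) (hSev : ∀ x : E, S (-x) = S x) :
    ∃ R₁ R₂ : E → F,
      (∀ f : E,
        IsLUB {y : F | ∃ g h : E, OrthDisjoint g h ∧ g + h = f ∧ y = T g + S h} (R₁ f)) ∧
      (∀ f : E,
        IsGLB {y : F | ∃ g h : E, OrthDisjoint g h ∧ g + h = f ∧ y = T g + S h} (R₂ f)) ∧
      (∀ f : E, R₁ (-f) = R₁ f) ∧ (∀ f : E, R₂ (-f) = R₂ f) := by
  have key : ∀ g h : E, OrthDisjoint g h → |g| ≤ |g + h| := by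
    intro g h hd
    have h1 : |g| - |g + h| ≤ |g| := sub_le_self _ (abs_nonneg _)
    have h2 : |g| - |g + h| ≤ |h| := by
      have h3 : |g| ≤ |g + h| + |h| := by
        have h4 := abs_add_le (g + h) (-h)
        rwa [abs_neg, add_neg_cancel_right] at h4
      exact sub_le_iff_le_add'.mpr h3
    have h5 := le_inf h1 h2
    rw [show |g| ⊓ |h| = 0 from hd] at h5
    exact sub_nonpos.mp h5
  have hsymm : ∀ g h : E, OrthDisjoint g h → OrthDisjoint h g := by
    intro g h hd
    unfold OrthDisjoint at *
    rwa [inf_comm]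
  have hneg : ∀ g h : E, OrthDisjoint g h → OrthDisjoint (-g) (-h) := by
    intro g h hd
    unfold OrthDisjoint at *
    rwa [abs_neg, abs_neg]
  have hmem : ∀ f g h : E, OrthDisjoint g h → g + h = f →
      g ∈ Set.Icc (-|f|) |f| ∧ h ∈ Set.Icc (-|f|) |f| := by
    intro f g h hd hf
    have h1 := key g h hd
    have h2 := key h g (hsymm g h hd)
    rw [add_comm h g, hf] at h2
    rw [hf] at h1
    exact ⟨⟨neg_le.mp ((neg_le_abs g).trans h1), (le_abs_self g).trans h1⟩,
      ⟨neg_le.mp ((neg_le_abs h).trans h2), (le_abs_self h).trans h2⟩⟩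
  let A : E → Set F := fun f =>
    {y : F | ∃ g h : E, OrthDisjoint g h ∧ g + h = f ∧ y = T g + S h}
  have hne : ∀ f, (A f).Nonempty := by
    intro f
    refine ⟨T f + S 0, f, 0, ?_, add_zero f, rfl⟩
    unfold OrthDisjoint
    rw [abs_zero]
    exact inf_eq_right.mpr (abs_nonneg f)
  have hsub : ∀ f, A f ⊆ A (-f) := by
    rintro f y ⟨g, h, hd, hf, rfl⟩
    refine ⟨-g, -h, hneg g h hd, ?_, by rw [hTev, hSev]⟩
    rw [← hf, neg_add]
  have heq : ∀ f, A (-f) = A f := by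
    intro f
    refine Set.Subset.antisymm ?_ (hsub f)
    have := hsub (-f)
    rwa [neg_neg] at this
  have hba : ∀ f, BddAbove (A f) := by
    intro f
    obtain ⟨-, a, ha⟩ := hTob (Set.Icc (-|f|) |f|) bddBelow_Icc bddAbove_Icc
    obtain ⟨-, b, hb⟩ := hSob (Set.Icc (-|f|) |f|) bddBelow_Icc bddAbove_Icc
    refine ⟨a + b, ?_⟩
    rintro y ⟨g, h, hd, hf, rfl⟩
    obtain ⟨hg, hh⟩ := hmem f g h hd hf
    exact add_le_add (ha ⟨g, hg, rfl⟩) (hb ⟨h, hh, rfl⟩)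
  have hbb : ∀ f, BddBelow (A f) := by
    intro f
    obtain ⟨⟨a, ha⟩, -⟩ := hTob (Set.Icc (-|f|) |f|) bddBelow_Icc bddAbove_Icc
    obtain ⟨⟨b, hb⟩, -⟩ := hSob (Set.Icc (-|f|) |f|) bddBelow_Icc bddAbove_Icc
    refine ⟨a + b, ?_⟩
    rintro y ⟨g, h, hd, hf, rfl⟩
    obtain ⟨hg, hh⟩ := hmem f g h hd hf
    exact add_le_add (ha ⟨g, hg, rfl⟩) (hb ⟨h, hh, rfl⟩)
  refine ⟨fun f => sSup (A f), fun f => sInf (A f), fun f => isLUB_csSup (hne f) (hba f),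
    fun f => isGLB_csInf (hne f) (hbb f), fun f => ?_, fun f => ?_⟩
  · show sSup (A (-f)) = sSup (A f)
    rw [heq]
  · show sInf (A (-f)) = sInf (A f)
    rw [heq]
end

section
/- Let D be a set, let ℓ_∞(D) denote the Banach space of bounded real-valued functions on D with the supremum norm, let H be a relatively compact (totally bounded) subset of ℓ_∞(D), and let ε > 0. Then there exists a continuous linear operator S : ℓ_∞(D) → ℓ_∞(D) of finite rank such that ‖x − S(x)‖ ≤ ε for every x ∈ H. -/
open scoped ENNReal

/-- If `H` is a relatively compact (totally bounded) subset of `ℓ_∞(D)` and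
`ε > 0`, then there is a finite-rank continuous linear operator
`S : ℓ_∞(D) → ℓ_∞(D)` such that `‖x - S x‖ ≤ ε` for every `x ∈ H`. -/
theorem exists_finiteRank_approx_linfty {D : Type*}
    (H : Set (lp (fun _ : D => ℝ) ∞)) (hH : TotallyBounded H) (ε : ℝ) (hε : 0 < ε) :
    ∃ S : lp (fun _ : D => ℝ) ∞ →L[ℝ] lp (fun _ : D => ℝ) ∞,
      FiniteDimensional ℝ (LinearMap.range (S : lp (fun _ : D => ℝ) ∞ →ₗ[ℝ] lp (fun _ : D => ℝ) ∞)) ∧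
      ∀ x ∈ H, ‖x - S x‖ ≤ ε := by
  have hε3 : 0 < ε / 3 := by positivity
  have hle : ∀ (x : lp (fun _ : D => ℝ) ∞) (d : D), |x d| ≤ ‖x‖ := fun x d =>
    lp.norm_apply_le_norm ENNReal.top_ne_zero x d
  obtain ⟨F, hF, hHF⟩ := Metric.totallyBounded_iff.1 hH (ε / 3) hε3
  have : Fintype F := hF.fintype
  let Φ : D → (F → ℝ) := fun d f => f.1 d
  have hΦb : Bornology.IsBounded (Set.range Φ) := by
    refine (Metric.isBounded_iff_subset_closedBall 0).2 ⟨∑ f : F, ‖f.1‖, ?_⟩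
    rintro _ ⟨d, rfl⟩
    rw [mem_closedBall_zero_iff, pi_norm_le_iff_of_nonneg (by positivity)]
    intro f
    exact (hle f.1 d).trans
      (Finset.single_le_sum (f := fun f : F => ‖f.1‖) (fun _ _ => norm_nonneg _) (Finset.mem_univ f))
  have hΦt : TotallyBounded (Set.range Φ) :=
    hΦb.isCompact_closure.totallyBounded.subset subset_closure
  obtain ⟨T, hTs, hT, hTc⟩ := Metric.finite_approx_of_totallyBounded hΦt (ε / 3) hε3
  have : Finite T := hT
  have : Fintype T := hT.fintype
  have h1 : ∀ d : D, ∃ t : T, dist (Φ d) t.1 < ε / 3 := by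
    intro d
    have := hTc (Set.mem_range_self d)
    simp only [Set.mem_iUnion, Metric.mem_ball] at this
    obtain ⟨t, ht, h⟩ := this
    exact ⟨⟨t, ht⟩, h⟩
  choose c hc using h1
  have h2 : ∀ t : T, ∃ d : D, Φ d = t.1 := fun t => hTs t.2
  choose s hs using h2
  have key : ∀ f ∈ F, ∀ d, |f d - f (s (c d))| ≤ ε / 3 := by
    intro f hf d
    have h := hc d
    rw [← hs (c d)] at h
    exact (dist_le_pi_dist (Φ d) (Φ (s (c d))) ⟨f, hf⟩).trans h.le
  let R : lp (fun _ : D => ℝ) ∞ →ₗ[ℝ] (T → ℝ) :=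
    { toFun := fun x t => x (s t)
      map_add' := fun x y => by ext t; simp
      map_smul' := fun a x => by ext t; simp }
  let G : (T → ℝ) →ₗ[ℝ] lp (fun _ : D => ℝ) ∞ :=
    { toFun := fun v => ⟨fun d => v (c d), memℓp_infty ⟨‖v‖, by
        rintro _ ⟨d, rfl⟩
        exact norm_le_pi_norm v (c d)⟩⟩
      map_add' := fun x y => by ext t; rfl
      map_smul' := fun a x => by ext t; rfl }
  have hGR : ∀ x d, (G (R x)) d = x (s (c d)) := fun x d => rfl
  let S : lp (fun _ : D => ℝ) ∞ →L[ℝ] lp (fun _ : D => ℝ) ∞ :=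
    (G ∘ₗ R).mkContinuous 1 (fun x => by
      rw [one_mul]
      refine lp.norm_le_of_forall_le (norm_nonneg x) fun d => ?_
      exact hle x (s (c d)))
  have hS : ∀ x d, (S x) d = x (s (c d)) := fun x d => rfl
  refine ⟨S, ?_, ?_⟩
  · have hr : LinearMap.range (S : lp (fun _ : D => ℝ) ∞ →ₗ[ℝ] lp (fun _ : D => ℝ) ∞)
        ≤ LinearMap.range G := by
      rintro _ ⟨x, rfl⟩
      exact ⟨R x, rfl⟩
    exact Submodule.finiteDimensional_of_le hr
  · intro x hx
    have := hHF hx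
    simp only [Set.mem_iUnion, Metric.mem_ball] at this
    obtain ⟨f, hf, hxf⟩ := this
    rw [dist_eq_norm] at hxf
    refine lp.norm_le_of_forall_le hε.le fun d => ?_
    have e1 := hle (x - f) d
    have e2 := hle (x - f) (s (c d))
    have e3 := key f hf d
    change |x d - f d| ≤ _ at e1
    change |x (s (c d)) - f (s (c d))| ≤ _ at e2
    change |x d - x (s (c d))| ≤ ε
    rw [abs_le] at *
    constructor <;> linarith [e1.1, e1.2, e2.1, e2.2, e3.1, e3.2]
end
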